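/- arXiv:2204.07378 — 3 statements merged into one kernel-verified Lean document; each statement's English description precedes it below -/
import Mathlib

section
/- For every nonempty subset S of the customer set {1,…,n} and every unitary cost c ≥ 0, the expected profit satisfies the recursion G(S,c) = G(S', (1 − π_{v^S})·c) + π_{v^S}·(p_{v^S} − l_{v^S}·c), where v^S is the largest index in S and S' = S \ {v^S}. -/
open Finset

/-- Expected revenue of a set of customers. -/
def R (pi p : ℕ → ℝ) (S : Finset ℕ) : ℝ := ∑ i ∈ S, pi i * p i

/-- Expected traveled distance (with l i = 2 * x i). -/
def L (x pi : ℕ → ℝ) (S : Finset ℕ) : ℝ :=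
  ∑ i ∈ S, (2 * x i) * pi i * ∏ j ∈ S.filter (fun j => i < j), (1 - pi j)

/-- Expected profit at unitary cost c. -/
def G (x pi p : ℕ → ℝ) (S : Finset ℕ) (c : ℝ) : ℝ := R pi p S - c * L x pi S

/-- Optimal value of the probabilistic profitable tour problem on a line. -/
def PPTP (n : ℕ) (x pi p : ℕ → ℝ) (c : ℝ) : ℝ :=
  (Finset.Icc 1 n).powerset.sup' (Finset.powerset_nonempty _) (fun S => G x pi p S c)

/-- Adding a last customer `a` scales the distance of the others by the probability that `a`
is absent. -/
theorem L_insert_of_forall_lt (x pi : ℕ → ℝ) {a : ℕ} {T : Finset ℕ} (h : ∀ i ∈ T, i < a) :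
    L x pi (insert a T) = 2 * x a * pi a + (1 - pi a) * L x pi T := by
  have ha : a ∉ T := fun ha => lt_irrefl a (h a ha)
  have h0 : (insert a T).filter (fun j => a < j) = ∅ := by
    refine Finset.filter_false_of_mem fun j hj => ?_
    rcases Finset.mem_insert.mp hj with rfl | hj
    · exact lt_irrefl _
    · exact (h j hj).not_gt
  unfold L
  rw [Finset.sum_insert ha, h0, Finset.prod_empty, mul_one, Finset.mul_sum]
  congr 1
  refine Finset.sum_congr rfl fun i hi => ?_
  rw [Finset.filter_insert, if_pos (h i hi),
    Finset.prod_insert fun hm => ha (Finset.mem_filter.mp hm).1]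
  ring

/-- Adding a last customer `a` rescales the unitary cost paid for the others. -/
theorem G_insert_of_forall_lt (x pi p : ℕ → ℝ) {a : ℕ} {T : Finset ℕ} (h : ∀ i ∈ T, i < a)
    (c : ℝ) :
    G x pi p (insert a T) c =
      G x pi p T ((1 - pi a) * c) + pi a * (p a - (2 * x a) * c) := by
  have ha : a ∉ T := fun ha => lt_irrefl a (h a ha)
  unfold G R
  rw [L_insert_of_forall_lt x pi h, Finset.sum_insert ha]
  ring

theorem stmt2 (n : ℕ) (x p pi : ℕ → ℝ)
    (hx : ∀ i ∈ Finset.Icc 1 n, 0 < x i)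
    (hxmono : ∀ i, 1 ≤ i → i + 1 ≤ n → x i ≤ x (i + 1))
    (hp : ∀ i ∈ Finset.Icc 1 n, 0 < p i)
    (hpi : ∀ i ∈ Finset.Icc 1 n, 0 < pi i ∧ pi i ≤ 1)
    (S : Finset ℕ) (hS : S ⊆ Finset.Icc 1 n) (hne : S.Nonempty)
    (c : ℝ) (hc : 0 ≤ c) :
    G x pi p S c =
      G x pi p (S.erase (S.max' hne)) ((1 - pi (S.max' hne)) * c)
        + pi (S.max' hne) * (p (S.max' hne) - (2 * x (S.max' hne)) * c) := by
  have h := G_insert_of_forall_lt x pi p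
    (fun i hi => S.lt_max'_of_mem_erase_max' hne hi) c
  rwa [Finset.insert_erase (S.max'_mem hne)] at h
end

section
/- If A and B are subsets of the customer set {1,…,n} with A strictly contained in B and both A and B are optimal at a unitary cost c̄ ≥ 0, then G(A,c) < G(B,c) for every c with 0 ≤ c < c̄, and G(A,c) > G(B,c) for every c > c̄. -/
open Finset

theorem stmt15 (n : ℕ) (x p pi : ℕ → ℝ)
    (hx : ∀ i ∈ Finset.Icc 1 n, 0 < x i)
    (hxmono : ∀ i, 1 ≤ i → i + 1 ≤ n → x i ≤ x (i + 1))
    (hp : ∀ i ∈ Finset.Icc 1 n, 0 < p i)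
    (hpi : ∀ i ∈ Finset.Icc 1 n, 0 < pi i ∧ pi i ≤ 1)
    (A B : Finset ℕ) (hA : A ⊆ Finset.Icc 1 n) (hB : B ⊆ Finset.Icc 1 n) (hAB : A ⊂ B)
    (cb : ℝ) (hcb : 0 ≤ cb)
    (hoptA : G x pi p A cb = PPTP n x pi p cb) (hoptB : G x pi p B cb = PPTP n x pi p cb) :
    (∀ c : ℝ, 0 ≤ c → c < cb → G x pi p A c < G x pi p B c) ∧
    (∀ c : ℝ, cb < c → G x pi p B c < G x pi p A c) := by
  have hR : R pi p A < R pi p B := by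
    obtain ⟨i, hiB, hiA⟩ := Finset.exists_of_ssubset hAB
    refine Finset.sum_lt_sum_of_subset hAB.subset hiB hiA
      (mul_pos (hpi i (hB hiB)).1 (hp i (hB hiB))) fun j hj _ => ?_
    exact (mul_pos (hpi j (hB hj)).1 (hp j (hB hj))).le
  have hG : R pi p B - R pi p A = cb * (L x pi B - L x pi A) := by
    have h := hoptA.trans hoptB.symm
    simp only [G] at h
    linarith
  have hL : 0 < L x pi B - L x pi A :=
    pos_of_mul_pos_right (hG ▸ sub_pos.mpr hR) hcb
  simp only [G]
  exact ⟨fun c _ hc => by linarith [mul_lt_mul_of_pos_right hc hL],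
    fun c hc => by linarith [mul_lt_mul_of_pos_right hc hL]⟩
end

section
/- Suppose at some unitary cost c̄ > 0 there exist two distinct optimal sets, and let A be the (unique) minimal optimal set and B the (unique) maximal optimal set at c̄. Then there exists ε > 0 such that B is optimal at every c with max(0, c̄ − ε) < c ≤ c̄, and A is optimal at every c with c̄ ≤ c < c̄ + ε. -/
open Finset

/-- Adding a customer beyond all others: it is visited with probability `pi m`, and otherwise the
tour is the one for the remaining customers. -/
lemma L_insert_of_lt (x pi : ℕ → ℝ) {m : ℕ} {S : Finset ℕ} (h : ∀ i ∈ S, i < m) :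
    L x pi (insert m S) = 2 * x m * pi m + (1 - pi m) * L x pi S := by
  have hm : m ∉ S := fun hm => lt_irrefl _ (h m hm)
  have hfilter : (insert m S).filter (fun j => m < j) = ∅ := by
    ext j
    simp only [mem_filter, mem_insert, notMem_empty, iff_false, not_and, not_lt]
    rintro (rfl | hj)
    · exact le_rfl
    · exact (h j hj).le
  unfold L
  rw [Finset.sum_insert hm, hfilter, Finset.prod_empty, mul_one, Finset.mul_sum]
  congr 1
  refine Finset.sum_congr rfl fun i hi => ?_
  rw [Finset.filter_insert, if_pos (h i hi),
    Finset.prod_insert (fun h' => hm (Finset.mem_of_mem_filter _ h'))]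
  ring

/-- The expected distance is at most the length of the longest possible tour. -/
lemma L_le_of_forall_le {x pi : ℕ → ℝ} {M : ℝ} (hM : 0 ≤ M) (T : Finset ℕ)
    (hx : ∀ i ∈ T, 2 * x i ≤ M) (hpi : ∀ i ∈ T, 0 ≤ pi i ∧ pi i ≤ 1) :
    L x pi T ≤ M := by
  induction T using Finset.induction_on_max with
  | empty => simpa [L] using hM
  | insert m T hlt ih =>
    rw [L_insert_of_lt x pi hlt]
    have ih := ih (fun i hi => hx i (mem_insert_of_mem hi))
      (fun i hi => hpi i (mem_insert_of_mem hi))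
    obtain ⟨h0, h1⟩ := hpi m (mem_insert_self m T)
    nlinarith [mul_le_mul_of_nonneg_right (hx m (mem_insert_self m T)) h0,
      mul_le_mul_of_nonneg_left ih (sub_nonneg.2 h1)]

/-- The expected distance is monotone under inclusion when positions are sorted. -/
lemma L_mono {x pi : ℕ → ℝ} {S T : Finset ℕ} (hST : S ⊆ T)
    (hx : ∀ i ∈ T, 0 ≤ x i) (hmono : MonotoneOn x T)
    (hpi : ∀ i ∈ T, 0 ≤ pi i ∧ pi i ≤ 1) :
    L x pi S ≤ L x pi T := by
  induction T using Finset.induction_on_max generalizing S with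
  | empty => rw [Finset.subset_empty.1 hST]
  | insert m T hlt ih =>
    have hsub : T ⊆ insert m T := subset_insert m T
    have hmT := mem_insert_self m T
    have ih {S' : Finset ℕ} (h : S' ⊆ T) : L x pi S' ≤ L x pi T :=
      ih h (fun i hi => hx i (hsub hi)) (hmono.mono (by exact_mod_cast hsub))
        (fun i hi => hpi i (hsub hi))
    obtain ⟨h0, h1⟩ := hpi m hmT
    rw [L_insert_of_lt x pi hlt]
    by_cases hm : m ∈ S
    · have hS' : S.erase m ⊆ T := Finset.subset_insert_iff.1 hST
      rw [← Finset.insert_erase hm, L_insert_of_lt x pi (fun i hi => hlt i (hS' hi))]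
      nlinarith [mul_le_mul_of_nonneg_left (ih hS') (sub_nonneg.2 h1)]
    · have hle := ih ((Finset.subset_insert_iff_of_notMem hm).1 hST)
      have hbound : L x pi T ≤ 2 * x m :=
        L_le_of_forall_le (by linarith [hx m hmT]) T
          (fun i hi => by
            linarith [hmono (by exact_mod_cast hsub hi) (by exact_mod_cast hmT) (hlt i hi).le])
          (fun i hi => hpi i (hsub hi))
      nlinarith [mul_le_mul_of_nonneg_right hbound h0]

lemma G_le_PPTP {n : ℕ} (x pi p : ℕ → ℝ) {S : Finset ℕ} (hS : S ⊆ Finset.Icc 1 n) (c : ℝ) :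
    G x pi p S c ≤ PPTP n x pi p c :=
  Finset.le_sup' (fun S => G x pi p S c) (Finset.mem_powerset.2 hS)

lemma G_eq_PPTP_of_forall_le {n : ℕ} {x pi p : ℕ → ℝ} {T : Finset ℕ} {c : ℝ}
    (hT : T ⊆ Finset.Icc 1 n)
    (h : ∀ S ⊆ Finset.Icc 1 n, G x pi p S c ≤ G x pi p T c) :
    G x pi p T c = PPTP n x pi p c :=
  (G_le_PPTP x pi p hT c).antisymm
    (Finset.sup'_le _ _ fun S hS => h S (Finset.mem_powerset.1 hS))

lemma continuous_G (x pi p : ℕ → ℝ) (S : Finset ℕ) : Continuous (G x pi p S) := by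
  unfold G
  fun_prop

/-- Near `cb`, an optimal set at `cb` beats every set that is not optimal at `cb`. -/
lemma eventually_G_lt {n : ℕ} {x pi p : ℕ → ℝ} {cb : ℝ} {T : Finset ℕ}
    (hT : G x pi p T cb = PPTP n x pi p cb) :
    ∀ᶠ c in nhds cb, ∀ S ∈ (Finset.Icc 1 n).powerset,
      G x pi p S cb ≠ PPTP n x pi p cb → G x pi p S c < G x pi p T c := by
  rw [Filter.eventually_all_finset]
  intro S hS
  by_cases h : G x pi p S cb = PPTP n x pi p cb
  · exact Filter.Eventually.of_forall fun c hc => absurd h hc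
  · have hlt : G x pi p S cb < G x pi p T cb :=
      hT ▸ (G_le_PPTP x pi p (Finset.mem_powerset.1 hS) cb).lt_of_ne h
    filter_upwards [(continuous_G x pi p S).continuousAt.eventually_lt
      (continuous_G x pi p T).continuousAt hlt] with c hc _ using hc

theorem stmt16 (n : ℕ) (x p pi : ℕ → ℝ)
    (hx : ∀ i ∈ Finset.Icc 1 n, 0 < x i)
    (hxmono : ∀ i, 1 ≤ i → i + 1 ≤ n → x i ≤ x (i + 1))
    (hp : ∀ i ∈ Finset.Icc 1 n, 0 < p i)
    (hpi : ∀ i ∈ Finset.Icc 1 n, 0 < pi i ∧ pi i ≤ 1)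
    (cb : ℝ) (hcb : 0 < cb)
    (S₁ S₂ : Finset ℕ) (hS₁ : S₁ ⊆ Finset.Icc 1 n) (hS₂ : S₂ ⊆ Finset.Icc 1 n)
    (hdist : S₁ ≠ S₂)
    (hopt₁ : G x pi p S₁ cb = PPTP n x pi p cb) (hopt₂ : G x pi p S₂ cb = PPTP n x pi p cb)
    (A B : Finset ℕ) (hA : A ⊆ Finset.Icc 1 n) (hB : B ⊆ Finset.Icc 1 n)
    (hoptA : G x pi p A cb = PPTP n x pi p cb) (hoptB : G x pi p B cb = PPTP n x pi p cb)
    (hAmin : ∀ S : Finset ℕ, S ⊆ Finset.Icc 1 n → G x pi p S cb = PPTP n x pi p cb → A ⊆ S)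
    (hBmax : ∀ S : Finset ℕ, S ⊆ Finset.Icc 1 n → G x pi p S cb = PPTP n x pi p cb → S ⊆ B) :
    ∃ ε : ℝ, 0 < ε ∧
      (∀ c : ℝ, max 0 (cb - ε) < c → c ≤ cb → G x pi p B c = PPTP n x pi p c) ∧
      (∀ c : ℝ, cb ≤ c → c < cb + ε → G x pi p A c = PPTP n x pi p c) := by
  have hmono : MonotoneOn x (Finset.Icc 1 n : Finset ℕ) := by
    rw [Finset.coe_Icc]
    refine monotoneOn_of_le_succ Set.ordConnected_Icc fun i _ hi hi' => ?_
    exact hxmono i hi.1 hi'.2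
  have hL {S T : Finset ℕ} (hST : S ⊆ T) (hT : T ⊆ Finset.Icc 1 n) : L x pi S ≤ L x pi T :=
    L_mono hST (fun i hi => (hx i (hT hi)).le) (hmono.mono (by exact_mod_cast hT))
      (fun i hi => ⟨(hpi i (hT hi)).1.le, (hpi i (hT hi)).2⟩)
  obtain ⟨ε, hε, hball⟩ := Metric.eventually_nhds_iff.1
    ((eventually_G_lt hoptA).and (eventually_G_lt hoptB))
  refine ⟨ε, hε, fun c hc hcle => ?_, fun c hcle hc => ?_⟩
  · have hc_dist : dist c cb < ε := by
      rw [Real.dist_eq, abs_lt]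
      constructor <;> linarith [(max_lt_iff.1 hc).2]
    refine G_eq_PPTP_of_forall_le hB fun S hS => ?_
    by_cases h : G x pi p S cb = PPTP n x pi p cb
    · have hle := hL (hBmax S hS h) hB
      have heq := h.trans hoptB.symm
      unfold G at heq ⊢
      nlinarith [mul_le_mul_of_nonneg_left hle (sub_nonneg.2 hcle)]
    · exact ((hball hc_dist).2 S (Finset.mem_powerset.2 hS) h).le
  · have hc_dist : dist c cb < ε := by
      rw [Real.dist_eq, abs_lt]
      constructor <;> linarith
    refine G_eq_PPTP_of_forall_le hA fun S hS => ?_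
    by_cases h : G x pi p S cb = PPTP n x pi p cb
    · have hle := hL (hAmin S hS h) hS
      have heq := h.trans hoptA.symm
      unfold G at heq ⊢
      nlinarith [mul_le_mul_of_nonneg_left hle (sub_nonneg.2 hcle)]
    · exact ((hball hc_dist).1 S (Finset.mem_powerset.2 hS) h).le
end
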